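/- arXiv:2510.21950 — 6 statements merged into one kernel-verified Lean document; each statement's English description precedes it below -/
import Mathlib

section
/- If states s and t satisfy that every node that is Glory in s is also Glory in t, then every node v ≠ g whose one-step update under the TieGlory policy with tolerance τ is Glory from state s also updates to Glory from state t. -/
/-- The forced state: agrees with `s` except the hub `g` is forced to Glory (`true`). -/
def forced {V : Type*} [DecidableEq V] (g : V) (s : V → Bool) : V → Bool :=
  fun u => if u = g then true else s u

/-- Glory score: total inbound weight to `v` from nodes in Glory (after forcing the hub). -/
def scoreG {V : Type*} [Fintype V] [DecidableEq V] (g : V) (w : V → V → ℕ)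
    (s : V → Bool) (v : V) : ℕ :=
  ∑ u, if forced g s u = true then w u v else 0

/-- Gnash score: total inbound weight to `v` from nodes in Gnash (after forcing the hub). -/
def scoreN {V : Type*} [Fintype V] [DecidableEq V] (g : V) (w : V → V → ℕ)
    (s : V → Bool) (v : V) : ℕ :=
  ∑ u, if forced g s u = false then w u v else 0

/-- Total inbound weight to `v`. -/
def totalIn {V : Type*} [Fintype V] (w : V → V → ℕ) (v : V) : ℕ :=
  ∑ u, w u v

/-- Inbound weight to `v` from non-hub nodes. -/
def restWeight {V : Type*} [Fintype V] [DecidableEq V] (g : V) (w : V → V → ℕ) (v : V) : ℕ :=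
  ∑ u ∈ Finset.univ.filter (fun u => u ≠ g), w u v

/-- One-step update under the TieGlory policy with tolerance `τ`:
the hub goes to Glory, and a non-hub node `v` goes to Glory iff
`scoreN s v ≤ scoreG s v + τ v`. -/
def nextTieGlory {V : Type*} [Fintype V] [DecidableEq V] (g : V) (w : V → V → ℕ)
    (τ : V → ℕ) (s : V → Bool) (v : V) : Bool :=
  if v = g then true else decide (scoreN g w s v ≤ scoreG g w s v + τ v)

theorem next_state_monotone {V : Type*} [Fintype V] [DecidableEq V]
    (g : V) (w : V → V → ℕ) (τ : V → ℕ) (s t : V → Bool)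
    (hst : ∀ u, s u = true → t u = true) (v : V) (hv : v ≠ g)
    (h : nextTieGlory g w τ s v = true) :
    nextTieGlory g w τ t v = true := by
  have hf : ∀ u, forced g s u = true → forced g t u = true := by
    intro u hu
    unfold forced at *
    split_ifs at * with h1
    · rfl
    · exact hst u hu
  have hG : scoreG g w s v ≤ scoreG g w t v := by
    unfold scoreG
    refine Finset.sum_le_sum fun u _ => ?_
    by_cases h1 : forced g s u = true
    · rw [if_pos h1, if_pos (hf u h1)]
    · rw [if_neg h1]; exact Nat.zero_le _
  have hN : scoreN g w t v ≤ scoreN g w s v := by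
    unfold scoreN
    refine Finset.sum_le_sum fun u _ => ?_
    by_cases h1 : forced g s u = true
    · simp [h1, hf u h1]
    · rw [if_pos (Bool.eq_false_iff.mpr h1)]
      split_ifs
      · exact le_rfl
      · exact Nat.zero_le _
  unfold nextTieGlory at *
  rw [if_neg hv, decide_eq_true_eq] at *
  omega
end

section
/- Suppose the hub weight is uniform: w(g,v) = W for every node v ≠ g. Then every node v ≠ g updates to Glory in one synchronous step under the TieGlory policy with tolerance τ from every initial state if and only if W + τ(v) ≥ rest_weight(v) for every v ≠ g. -/
theorem uniform_hub_with_tolerance_exact {V : Type*} [Fintype V] [DecidableEq V]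
    (g : V) (w : V → V → ℕ) (τ : V → ℕ) (W : ℕ)
    (hW : ∀ v, v ≠ g → w g v = W) :
    (∀ s : V → Bool, ∀ v, v ≠ g → nextTieGlory g w τ s v = true) ↔
      (∀ v, v ≠ g → W + τ v ≥ restWeight g w v) := by
  constructor
  · intro h v hv
    have h1 := h (fun _ => false) v hv
    simp only [nextTieGlory, hv, if_false, decide_eq_true_eq] at h1
    have hG : scoreG g w (fun _ => false) v = W := by
      simp [scoreG, forced, hW v hv]
    have hN : scoreN g w (fun _ => false) v = restWeight g w v := by
      simp [scoreN, restWeight, forced, Finset.sum_filter]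
    rw [hG, hN] at h1
    exact h1
  · intro h s v hv
    simp only [nextTieGlory, hv, if_false, decide_eq_true_eq]
    have hG : W ≤ scoreG g w s v := by
      have h2 := Finset.single_le_sum
        (f := fun u => if forced g s u = true then w u v else 0)
        (fun _ _ => Nat.zero_le _) (Finset.mem_univ g)
      simpa [scoreG, forced, hW v hv] using h2
    have hN : scoreN g w s v ≤ restWeight g w v := by
      unfold scoreN restWeight
      rw [Finset.sum_filter]
      apply Finset.sum_le_sum
      intro u _
      by_cases hu : u = g
      · simp [forced, hu]
      · simp only [forced, hu, if_false, ne_eq, not_false_eq_true, if_true]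
        split_ifs <;> simp
    have := h v hv
    omega
end

section
/- Suppose the hub weight is uniform, w(g,v) = W for every node v ≠ g, and the tolerance is zero everywhere. Then every node v ≠ g updates to Glory in one synchronous step under the TieGlory policy from every initial state if and only if W ≥ rest_weight(v) for every v ≠ g. -/
theorem uniform_hub_no_tolerance_exact {V : Type*} [Fintype V] [DecidableEq V]
    (g : V) (w : V → V → ℕ) (W : ℕ)
    (hW : ∀ v, v ≠ g → w g v = W) :
    (∀ s : V → Bool, ∀ v, v ≠ g → nextTieGlory g w (fun _ => 0) s v = true) ↔
      (∀ v, v ≠ g → W ≥ restWeight g w v) := by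
  constructor
  · intro h v hv
    have h1 := h (fun _ => false) v hv
    simp only [nextTieGlory, if_neg hv, decide_eq_true_eq, add_zero] at h1
    have hN : scoreN g w (fun _ => false) v = restWeight g w v := by
      unfold scoreN restWeight
      rw [Finset.sum_filter]
      refine Finset.sum_congr rfl fun u _ => ?_
      by_cases hu : u = g <;> simp [forced, hu]
    have hG : scoreG g w (fun _ => false) v = W := by
      unfold scoreG
      rw [← hW v hv, Finset.sum_eq_single g]
      · simp [forced]
      · intro u _ hu
        simp [forced, hu]
      · simp
    omega
  · intro h s v hv
    simp only [nextTieGlory, if_neg hv, decide_eq_true_eq, add_zero]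
    have hN : scoreN g w s v ≤ restWeight g w v := by
      unfold scoreN restWeight
      rw [Finset.sum_filter]
      refine Finset.sum_le_sum fun u _ => ?_
      by_cases hu : u = g
      · simp [forced, hu]
      · simp only [forced, hu, if_false, ne_eq, not_false_eq_true, if_true]
        split_ifs <;> simp
    have hG : W ≤ scoreG g w s v := by
      unfold scoreG
      have := Finset.single_le_sum (f := fun u => if forced g s u = true then w u v else 0)
        (fun _ _ => Nat.zero_le _) (Finset.mem_univ g)
      simpa [forced, hW v hv] using this
    exact hN.trans ((h v hv).trans hG)
end

section
/- Let H be a set of seed nodes. Every node v ∉ H updates to Glory in one synchronous step under the seeded TieGlory policy with tolerance τ from every initial state if and only if hub_H(v) + τ(v) ≥ rest_H(v) for every v ∉ H. -/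
/-- The H-forced state: agrees with `s` except every node of `H` is forced to Glory (`true`). -/
def forcedH {V : Type*} [DecidableEq V] (H : Finset V) (s : V → Bool) : V → Bool :=
  fun u => if u ∈ H then true else s u

/-- Glory score: total inbound weight to `v` from nodes in Glory (after forcing `H`). -/
def scoreGH {V : Type*} [Fintype V] [DecidableEq V] (H : Finset V) (w : V → V → ℕ)
    (s : V → Bool) (v : V) : ℕ :=
  ∑ u, if forcedH H s u = true then w u v else 0

/-- Gnash score: total inbound weight to `v` from nodes in Gnash (after forcing `H`). -/
def scoreNH {V : Type*} [Fintype V] [DecidableEq V] (H : Finset V) (w : V → V → ℕ)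
    (s : V → Bool) (v : V) : ℕ :=
  ∑ u, if forcedH H s u = false then w u v else 0

/-- Collective inbound influence of the seed set `H` on `v`. -/
def hubH {V : Type*} [Fintype V] [DecidableEq V] (H : Finset V) (w : V → V → ℕ) (v : V) : ℕ :=
  ∑ u ∈ H, w u v

/-- Inbound weight to `v` from nodes outside the seed set `H`. -/
def restH {V : Type*} [Fintype V] [DecidableEq V] (H : Finset V) (w : V → V → ℕ) (v : V) : ℕ :=
  ∑ u ∈ Hᶜ, w u v

/-- One-step update under the seeded TieGlory policy with tolerance `τ`:
nodes in `H` go to Glory, and a node `v ∉ H` goes to Glory iff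
`scoreNH s v ≤ scoreGH s v + τ v`. -/
def nextSeeded {V : Type*} [Fintype V] [DecidableEq V] (H : Finset V) (w : V → V → ℕ)
    (τ : V → ℕ) (s : V → Bool) (v : V) : Bool :=
  if v ∈ H then true else decide (scoreNH H w s v ≤ scoreGH H w s v + τ v)

theorem hubH_eq_aux {V : Type*} [Fintype V] [DecidableEq V] (H : Finset V) (w : V → V → ℕ)
    (v : V) : hubH H w v = ∑ u, if u ∈ H then w u v else 0 := by
  simp [hubH]

theorem restH_eq_aux {V : Type*} [Fintype V] [DecidableEq V] (H : Finset V) (w : V → V → ℕ)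
    (v : V) : restH H w v = ∑ u, if u ∈ H then 0 else w u v := by
  rw [restH, ← Finset.sum_subset (Finset.subset_univ Hᶜ)]
  · apply Finset.sum_congr rfl
    intro u hu
    rw [if_neg (Finset.mem_compl.mp hu)]
  · intro u _ hu
    rw [if_pos (by simpa using hu)]

theorem seeded_one_step_exact {V : Type*} [Fintype V] [DecidableEq V]
    (H : Finset V) (w : V → V → ℕ) (τ : V → ℕ) :
    (∀ s : V → Bool, ∀ v, v ∉ H → nextSeeded H w τ s v = true) ↔
      (∀ v, v ∉ H → hubH H w v + τ v ≥ restH H w v) := by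
  constructor
  · intro h v hv
    have h1 := h (fun _ => false) v hv
    simp only [nextSeeded, if_neg hv, decide_eq_true_eq] at h1
    have hN : scoreNH H w (fun _ => false) v = restH H w v := by
      rw [restH_eq_aux, scoreNH]
      apply Finset.sum_congr rfl
      intro u _
      by_cases hu : u ∈ H <;> simp [forcedH, hu]
    have hG : scoreGH H w (fun _ => false) v = hubH H w v := by
      rw [hubH_eq_aux, scoreGH]
      apply Finset.sum_congr rfl
      intro u _
      by_cases hu : u ∈ H <;> simp [forcedH, hu]
    rw [hN, hG] at h1
    exact h1
  · intro h s v hv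
    have h1 := h v hv
    simp only [nextSeeded, if_neg hv, decide_eq_true_eq]
    have hN : scoreNH H w s v ≤ restH H w v := by
      rw [restH_eq_aux, scoreNH]
      apply Finset.sum_le_sum
      intro u _
      by_cases hu : u ∈ H <;> cases hs : s u <;> simp [forcedH, hu, hs]
    have hG : hubH H w v ≤ scoreGH H w s v := by
      rw [hubH_eq_aux, scoreGH]
      apply Finset.sum_le_sum
      intro u _
      by_cases hu : u ∈ H <;> simp [forcedH, hu]
    omega
end

section
/- Suppose w(g,v) + τ(v) ≥ rest_weight(v) for every node v ≠ g. Let sched be a finite list of nodes that contains every node v ≠ g at least once, and let the final state be obtained from any initial state s by processing sched in order, where processing a node u replaces the state's value at u by the one-step TieGlory update of the current state at u (and forces the state at u to Glory when u = g). Then in the final state, every node v ≠ g is Glory. -/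
/-- Asynchronously process one node: replace the state's value at `u` by the
one-step TieGlory update of the current state at `u`. -/
def asyncStep {V : Type*} [Fintype V] [DecidableEq V] (g : V) (w : V → V → ℕ)
    (τ : V → ℕ) (s : V → Bool) (u : V) : V → Bool :=
  Function.update s u (nextTieGlory g w τ s u)

theorem next_glory_aux {V : Type*} [Fintype V] [DecidableEq V]
    (g : V) (w : V → V → ℕ) (τ : V → ℕ)
    (h : ∀ v, v ≠ g → w g v + τ v ≥ restWeight g w v)
    (s : V → Bool) (v : V) : nextTieGlory g w τ s v = true := by
  unfold nextTieGlory
  split_ifs with hv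
  · rfl
  · have h1 : scoreN g w s v ≤ restWeight g w v := by
      unfold scoreN restWeight
      rw [Finset.sum_filter]
      apply Finset.sum_le_sum
      intro u _
      by_cases hu : u = g
      · simp [forced, hu]
      · simp only [ne_eq, hu, not_false_eq_true, if_true]
        split_ifs <;> simp
    have h2 : w g v ≤ scoreG g w s v := by
      unfold scoreG
      have := Finset.single_le_sum
        (f := fun u => if forced g s u = true then w u v else 0)
        (fun i _ => Nat.zero_le _) (Finset.mem_univ g)
      simpa [forced] using this
    have h3 := h v hv
    simp only [decide_eq_true_eq]
    omega

theorem fold_glory_aux {V : Type*} [Fintype V] [DecidableEq V]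
    (g : V) (w : V → V → ℕ) (τ : V → ℕ)
    (h : ∀ v, v ≠ g → w g v + τ v ≥ restWeight g w v) (v : V)
    (sched : List V) : ∀ s : V → Bool, (v ∈ sched ∨ s v = true) →
    (sched.foldl (asyncStep g w τ) s) v = true := by
  induction sched with
  | nil => intro s hs; simpa using hs
  | cons a l ih =>
    intro s hs
    rw [List.foldl_cons]
    apply ih
    by_cases hva : v = a
    · right
      subst hva
      simp [asyncStep, next_glory_aux g w τ h]
    · rcases hs with hs | hs
      · left
        simpa [hva] using hs
      · right
        simpa [asyncStep, Function.update_of_ne hva] using hs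

theorem one_pass_fairness {V : Type*} [Fintype V] [DecidableEq V]
    (g : V) (w : V → V → ℕ) (τ : V → ℕ)
    (h : ∀ v, v ≠ g → w g v + τ v ≥ restWeight g w v)
    (sched : List V) (hsched : ∀ v, v ≠ g → v ∈ sched)
    (s : V → Bool) :
    ∀ v, v ≠ g → (sched.foldl (asyncStep g w τ) s) v = true := by
  exact fun v hv => fold_glory_aux g w τ h v sched s (Or.inl (hsched v hv))
end

section
/- Suppose w(g,v) + τ(v) ≥ rest_weight(v) for every node v ≠ g. If a state s has s(v) = Glory for a node v ≠ g, then after asynchronously updating any single node u (replacing s(u) by the one-step TieGlory update of s at u), the resulting state still has v in Glory. -/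
theorem glory_persists_async {V : Type*} [Fintype V] [DecidableEq V]
    (g : V) (w : V → V → ℕ) (τ : V → ℕ)
    (h : ∀ v, v ≠ g → w g v + τ v ≥ restWeight g w v)
    (s : V → Bool) (u v : V) (hv : v ≠ g) (hs : s v = true) :
    Function.update s u (nextTieGlory g w τ s u) v = true := by
  by_cases huv : v = u
  · subst huv
    have h1 : scoreN g w s v ≤ restWeight g w v := by
      unfold scoreN restWeight
      rw [Finset.sum_filter]
      apply Finset.sum_le_sum
      intro x _
      by_cases hx : x = g
      · simp [forced, hx]
      · simp only [ne_eq, hx, not_false_eq_true, if_true]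
        split_ifs <;> simp
    have h2 : w g v ≤ scoreG g w s v := by
      unfold scoreG
      have := Finset.single_le_sum (f := fun u => if forced g s u = true then w u v else 0)
        (fun i _ => Nat.zero_le _) (Finset.mem_univ g)
      simpa [forced] using this
    have h3 := h v hv
    simp only [Function.update_self, nextTieGlory, hv, if_false, decide_eq_true_eq]
    omega
  · rw [Function.update_of_ne huv]
    exact hs
end
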